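/- arXiv:1601.02096 — 7 statements merged into one kernel-verified Lean document; each statement's English description precedes it below -/
import Mathlib

section
/- Let a, b, c : W → ℝ be functions on an open set W ⊆ ℝ², let V ⊆ ℝ² be open and f : V → ℝ differentiable with ∂₂f(x̃,ỹ) ≠ 0 and 3∂₁f(x̃,ỹ) + a(x̃, f(x̃,ỹ)) = 0 for all (x̃,ỹ) ∈ V. Let I ⊆ ℝ be an interval, ỹ : I → ℝ differentiable with (x, ỹ(x)) ∈ V for all x ∈ I, and set y(x) = f(x, ỹ(x)). Then y'(x)^3 + a(x,y(x)) y'(x)^2 + b(x,y(x)) y'(x) + c(x,y(x)) = 0 holds on I if and only if ỹ'(x)^3 + Ã(x, ỹ(x)) ỹ'(x) + B̃(x, ỹ(x)) = 0 holds on I, where Ã(x̃,ỹ) = (3(∂₁f)^2 + 2a(x̃,f)∂₁f + b(x̃,f)) / (∂₂f)^2 and B̃(x̃,ỹ) = ((∂₁f)^3 + a(x̃,f)(∂₁f)^2 + b(x̃,f)∂₁f + c(x̃,f)) / (∂₂f)^3, with all partial derivatives of f evaluated at (x̃,ỹ) and a, b, c evaluated at (x̃, f(x̃,ỹ)). -/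
/-- Chain rule along the graph of `u`, in terms of the partial derivatives of `f`. -/
theorem deriv_comp_graph {f : ℝ × ℝ → ℝ} {u : ℝ → ℝ} {x : ℝ}
    (hf : DifferentiableAt ℝ f (x, u x)) (hu : DifferentiableAt ℝ u x) :
    deriv (fun t => f (t, u t)) x =
      fderiv ℝ f (x, u x) (1, 0) + fderiv ℝ f (x, u x) (0, 1) * deriv u x := by
  have h := hf.hasFDerivAt.comp_hasDerivAt x ((hasDerivAt_id x).prodMk hu.hasDerivAt)
  refine h.deriv.trans ?_
  have hsplit : ((1 : ℝ), deriv u x) = (1, 0) + deriv u x • ((0 : ℝ), (1 : ℝ)) := by simp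
  rw [hsplit, map_add, map_smul, smul_eq_mul, mul_comm]

/-- A monic cubic evaluated at `f₁ + f₂ s` is `f₂ ^ 3` times a depressed cubic in `s`
when `3 f₁ + a = 0`. -/
theorem cubic_comp_affine {K : Type*} [Field K] {a b c f₁ f₂ s : K} (h₂ : f₂ ≠ 0)
    (h : 3 * f₁ + a = 0) :
    (f₁ + f₂ * s) ^ 3 + a * (f₁ + f₂ * s) ^ 2 + b * (f₁ + f₂ * s) + c =
      f₂ ^ 3 * (s ^ 3 + (3 * f₁ ^ 2 + 2 * a * f₁ + b) / f₂ ^ 2 * s +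
        (f₁ ^ 3 + a * f₁ ^ 2 + b * f₁ + c) / f₂ ^ 3) := by
  field_simp
  linear_combination f₂ ^ 2 * s ^ 2 * h

/-- The differential analog of the Tschirnhausen transformation: the change of variables
`y = f(x̃, ỹ)`, `x = x̃` with `3∂₁f + a(x̃, f) = 0` transforms solutions of the monic cubic
implicit ODE `p³ + a p² + b p + c = 0` into solutions of the depressed cubic
`p̃³ + Ã p̃ + B̃ = 0`, and vice versa. -/
theorem tschirnhausen_transformation
    (a b c : ℝ × ℝ → ℝ)
    (V : Set (ℝ × ℝ)) (hV : IsOpen V)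
    (f : ℝ × ℝ → ℝ)
    (hfdiff : ∀ q ∈ V, DifferentiableAt ℝ f q)
    (hf2 : ∀ q ∈ V, fderiv ℝ f q (0, 1) ≠ 0)
    (htsch : ∀ q ∈ V, 3 * fderiv ℝ f q (1, 0) + a (q.1, f q) = 0)
    (I : Set ℝ) (hI : I.OrdConnected)
    (yt : ℝ → ℝ) (hyt : ∀ x ∈ I, DifferentiableAt ℝ yt x)
    (hIV : ∀ x ∈ I, (x, yt x) ∈ V)
    (y : ℝ → ℝ) (hy : ∀ x, y x = f (x, yt x))
    (At Bt : ℝ × ℝ → ℝ)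
    (hAt : ∀ q ∈ V, At q =
      (3 * (fderiv ℝ f q (1, 0)) ^ 2 + 2 * a (q.1, f q) * fderiv ℝ f q (1, 0)
        + b (q.1, f q)) / (fderiv ℝ f q (0, 1)) ^ 2)
    (hBt : ∀ q ∈ V, Bt q =
      ((fderiv ℝ f q (1, 0)) ^ 3 + a (q.1, f q) * (fderiv ℝ f q (1, 0)) ^ 2
        + b (q.1, f q) * fderiv ℝ f q (1, 0) + c (q.1, f q)) / (fderiv ℝ f q (0, 1)) ^ 3) :
    (∀ x ∈ I, (deriv y x) ^ 3 + a (x, y x) * (deriv y x) ^ 2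
        + b (x, y x) * deriv y x + c (x, y x) = 0) ↔
    (∀ x ∈ I, (deriv yt x) ^ 3 + At (x, yt x) * deriv yt x + Bt (x, yt x) = 0) := by
  obtain rfl : y = fun x => f (x, yt x) := funext hy
  refine forall₂_congr fun x hx => ?_
  have hq := hIV x hx
  rw [deriv_comp_graph (hfdiff _ hq) (hyt x hx), hAt _ hq, hBt _ hq,
    cubic_comp_affine (hf2 _ hq) (htsch _ hq), mul_eq_zero_iff_left (pow_ne_zero 3 (hf2 _ hq))]
end

section
/- Let U ⊆ ℝ² be open and let p₁, p₂, p₃ : U → ℝ be differentiable functions with p₁ + p₂ + p₃ = 0 on U. Set A = p₁p₂ + p₂p₃ + p₃p₁ and B = −p₁p₂p₃, and assume 4A³ + 27B² ≠ 0 on U. For each cyclic permutation (i,j,k) of (1,2,3) define the 1-form σᵢ = Pᵢ dx + Qᵢ dy with Pᵢ = −pᵢ(pⱼ − pₖ) and Qᵢ = pⱼ − pₖ. Then, with γ₁ = (2A²A_x − 4A²B_y + 6ABA_y + 9BB_x)/(4A³ + 27B²) and γ₂ = (4A²A_y + 6AB_x + 18BB_y − 9BA_x)/(4A³ + 27B²)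 (subscripts denoting partial derivatives), the identity ∂Qᵢ/∂x − ∂Pᵢ/∂y = γ₁ Qᵢ − γ₂ Pᵢ holds on U for each i = 1, 2, 3; that is, dσᵢ = γ ∧ σᵢ for the Chern connection form γ = γ₁ dx + γ₂ dy. -/
/-- The coefficient identity `dσ = γ ∧ σ` at a point, for `σ = (b - c)(dy - a dx)`, where
`a, b, c` are the roots of `p³ + Ap + B` and the remaining variables are partial derivatives. -/
lemma chern_connection_coeff {a b c a_x b_x c_x a_y b_y c_y A B Ax Ay Bx By : ℝ}
    (h : a + b + c = 0) (hx : a_x + b_x + c_x = 0) (hy : a_y + b_y + c_y = 0)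
    (hA : A = a * b + b * c + c * a) (hB : B = -(a * b * c))
    (hAx : Ax = a_x * b + a * b_x + (b_x * c + b * c_x) + (c_x * a + c * a_x))
    (hAy : Ay = a_y * b + a * b_y + (b_y * c + b * c_y) + (c_y * a + c * a_y))
    (hBx : Bx = -(a_x * b * c + a * b_x * c + a * b * c_x))
    (hBy : By = -(a_y * b * c + a * b_y * c + a * b * c_y))
    (hD : 4 * A ^ 3 + 27 * B ^ 2 ≠ 0) :
    b_x - c_x + (a_y * (b - c) + a * (b_y - c_y)) =
      (2 * A ^ 2 * Ax - 4 * A ^ 2 * By + 6 * A * B * Ay + 9 * B * Bx) /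
          (4 * A ^ 3 + 27 * B ^ 2) * (b - c) -
        (4 * A ^ 2 * Ay + 6 * A * Bx + 18 * B * By - 9 * B * Ax) /
          (4 * A ^ 3 + 27 * B ^ 2) * (-a * (b - c)) := by
  rw [div_mul_eq_mul_div, div_mul_eq_mul_div, ← sub_div, eq_div_iff hD]
  obtain rfl : c = -a - b := by linarith
  obtain rfl : c_x = -a_x - b_x := by linarith
  obtain rfl : c_y = -a_y - b_y := by linarith
  subst hA hB hAx hAy hBx hBy
  ring

/-- For the 3-web of the cubic ODE `p³ + Ap + B = 0` with root functions `p₁, p₂, p₃`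
(satisfying `p₁ + p₂ + p₃ = 0`), the Blaschke-normalized forms
`σᵢ = Pᵢ dx + Qᵢ dy` with `Pᵢ = -pᵢ(pⱼ - pₖ)`, `Qᵢ = pⱼ - pₖ` satisfy
`dσᵢ = γ ∧ σᵢ`, i.e. `∂Qᵢ/∂x − ∂Pᵢ/∂y = γ₁Qᵢ − γ₂Pᵢ`, for the Chern connection form
`γ = γ₁ dx + γ₂ dy` given b_y the stated rational expressions in `A`, `B` and their
partial derivatives. -/
theorem chern_connection_identity
    (U : Set (ℝ × ℝ)) (hU : IsOpen U)
    (p1 p2 p3 : ℝ × ℝ → ℝ)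
    (hp1 : ∀ z ∈ U, DifferentiableAt ℝ p1 z)
    (hp2 : ∀ z ∈ U, DifferentiableAt ℝ p2 z)
    (hp3 : ∀ z ∈ U, DifferentiableAt ℝ p3 z)
    (hsum : ∀ z ∈ U, p1 z + p2 z + p3 z = 0)
    (A B : ℝ × ℝ → ℝ)
    (hA : ∀ z, A z = p1 z * p2 z + p2 z * p3 z + p3 z * p1 z)
    (hB : ∀ z, B z = -(p1 z * p2 z * p3 z))
    (hdisc : ∀ z ∈ U, 4 * (A z) ^ 3 + 27 * (B z) ^ 2 ≠ 0)
    (γ1 γ2 : ℝ × ℝ → ℝ)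
    (hγ1 : ∀ z, γ1 z =
      (2 * (A z) ^ 2 * fderiv ℝ A z (1, 0) - 4 * (A z) ^ 2 * fderiv ℝ B z (0, 1)
        + 6 * A z * B z * fderiv ℝ A z (0, 1) + 9 * B z * fderiv ℝ B z (1, 0)) /
      (4 * (A z) ^ 3 + 27 * (B z) ^ 2))
    (hγ2 : ∀ z, γ2 z =
      (4 * (A z) ^ 2 * fderiv ℝ A z (0, 1) + 6 * A z * fderiv ℝ B z (1, 0)
        + 18 * B z * fderiv ℝ B z (0, 1) - 9 * B z * fderiv ℝ A z (1, 0)) /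
      (4 * (A z) ^ 3 + 27 * (B z) ^ 2)) :
    ∀ z ∈ U,
      (fderiv ℝ (fun w => p2 w - p3 w) z (1, 0)
          - fderiv ℝ (fun w => -(p1 w) * (p2 w - p3 w)) z (0, 1)
        = γ1 z * (p2 z - p3 z) - γ2 z * (-(p1 z) * (p2 z - p3 z))) ∧
      (fderiv ℝ (fun w => p3 w - p1 w) z (1, 0)
          - fderiv ℝ (fun w => -(p2 w) * (p3 w - p1 w)) z (0, 1)
        = γ1 z * (p3 z - p1 z) - γ2 z * (-(p2 z) * (p3 z - p1 z))) ∧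
      (fderiv ℝ (fun w => p1 w - p2 w) z (1, 0)
          - fderiv ℝ (fun w => -(p3 w) * (p1 w - p2 w)) z (0, 1)
        = γ1 z * (p1 z - p2 z) - γ2 z * (-(p3 z) * (p1 z - p2 z))) := by
  intro z hz
  have d1 := (hp1 z hz).hasFDerivAt
  have d2 := (hp2 z hz).hasFDerivAt
  have d3 := (hp3 z hz).hasFDerivAt
  have hdA := ((d1.mul d2).add (d2.mul d3)).add (d3.mul d1)
  have hdB := ((d1.mul d2).mul d3).neg
  have hfA : fderiv ℝ A z = _ := (hdA.congr_of_eventuallyEq (.of_forall hA)).fderiv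
  have hfB : fderiv ℝ B z = _ := (hdB.congr_of_eventuallyEq (.of_forall hB)).fderiv
  have hzero : fderiv ℝ p1 z + fderiv ℝ p2 z + fderiv ℝ p3 z = 0 :=
    ((d1.add d2).add d3).unique <| (hasFDerivAt_const (0 : ℝ) z).congr_of_eventuallyEq <|
      Filter.eventually_of_mem (hU.mem_nhds hz) hsum
  have hx : fderiv ℝ p1 z (1, 0) + fderiv ℝ p2 z (1, 0) + fderiv ℝ p3 z (1, 0) = 0 :=
    DFunLike.congr_fun hzero (1, 0)
  have hy : fderiv ℝ p1 z (0, 1) + fderiv ℝ p2 z (0, 1) + fderiv ℝ p3 z (0, 1) = 0 :=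
    DFunLike.congr_fun hzero (0, 1)
  have hsub {f g : ℝ × ℝ → ℝ} (hf : DifferentiableAt ℝ f z) (hg : DifferentiableAt ℝ g z) :
      fderiv ℝ (fun w => f w - g w) z = fderiv ℝ f z - fderiv ℝ g z := fderiv_fun_sub hf hg
  have hmul {e f g : ℝ × ℝ → ℝ} (he : DifferentiableAt ℝ e z) (hf : DifferentiableAt ℝ f z)
      (hg : DifferentiableAt ℝ g z) :
      fderiv ℝ (fun w => -(e w) * (f w - g w)) z (0, 1) =
        -(fderiv ℝ e z (0, 1) * (f z - g z) +
          e z * (fderiv ℝ f z (0, 1) - fderiv ℝ g z (0, 1))) := by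
    have hd : fderiv ℝ (fun w => -(e w) * (f w - g w)) z = _ :=
      (he.hasFDerivAt.neg.mul (hf.hasFDerivAt.sub hg.hasFDerivAt)).fderiv
    rw [hd]
    simp
    ring
  have hs := hsum z hz
  have hD := hdisc z hz
  rw [hγ1, hγ2, hsub (hp2 z hz) (hp3 z hz), hsub (hp3 z hz) (hp1 z hz),
    hsub (hp1 z hz) (hp2 z hz), hmul (hp1 z hz) (hp2 z hz) (hp3 z hz),
    hmul (hp2 z hz) (hp3 z hz) (hp1 z hz), hmul (hp3 z hz) (hp1 z hz) (hp2 z hz)]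
  simp only [sub_neg_eq_add, sub_apply]
  refine ⟨chern_connection_coeff hs hx hy (hA z) (hB z) ?_ ?_ ?_ ?_ hD,
    chern_connection_coeff (a_x := fderiv ℝ p2 z (1, 0))
      (by linarith) (by linarith) (by linarith) ?_ ?_ ?_ ?_ ?_ ?_ hD,
    chern_connection_coeff (a_x := fderiv ℝ p3 z (1, 0))
      (by linarith) (by linarith) (by linarith) ?_ ?_ ?_ ?_ ?_ ?_ hD⟩ <;>
  first
  | (rw [hA]; ring)
  | (rw [hB]; ring)
  | (rw [hfA]; simp; ring)
  | (rw [hfB]; simp; ring)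
end

section
/- Let A, B : ℝ² → ℝ be differentiable at z₀ = (x₀,y₀) and let p₀ ∈ ℝ satisfy p₀³ + A(z₀)p₀ + B(z₀) = 0 and 3p₀² + A(z₀) = 0. Then, with all values and partial derivatives taken at z₀, the 2×3 matrix with rows (A_x p₀ + B_x, A_y p₀ + B_y, 0) and (A_x, A_y, 6p₀) has rank less than 2 if and only if the four equations hold: 4A³ + 27B² = 0, A_x B_y − A_y B_x = 0, 3BA_x − 2AB_x = 0, and 3BA_y − 2AB_y = 0 (the first of which holds automatically under the stated hypotheses on p₀). -/
/-- A matrix has rank less than its number of rows iff its rows are linearly dependent. -/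
theorem Matrix.rank_lt_card_height_iff {m n K : Type*} [Fintype m] [Fintype n] [Field K]
    (M : Matrix m n K) : M.rank < Fintype.card m ↔ ¬ LinearIndependent K M.row := by
  rw [linearIndependent_iff_card_eq_finrank_span, Set.finrank, ← M.rank_eq_finrank_span_row,
    M.rank_le_card_height.lt_iff_ne, ne_comm]

/-- A `2 × 3` matrix has rank less than `2` iff its three maximal minors vanish. -/
theorem Matrix.rank_lt_two_iff_minors {K : Type*} [Field K] (a b c d e f : K) :
    (!![a, b, c; d, e, f]).rank < 2 ↔
      a * e - b * d = 0 ∧ a * f - c * d = 0 ∧ b * f - c * e = 0 := by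
  have hrow : (!![a, b, c; d, e, f]).row = ![![a, b, c], ![d, e, f]] := rfl
  have hcard := Matrix.rank_lt_card_height_iff !![a, b, c; d, e, f]
  rw [Fintype.card_fin, hrow, LinearIndependent.pair_iff] at hcard
  simp only [Matrix.smul_cons, smul_eq_mul, Matrix.smul_empty, Matrix.add_cons,
    Matrix.head_cons, Matrix.tail_cons, Matrix.empty_add_empty, Matrix.cons_eq_zero_iff,
    Matrix.zero_empty, and_true] at hcard
  rw [hcard]
  constructor
  · intro h
    push Not at h
    obtain ⟨s, t, ⟨h₁, h₂, h₃⟩, hst⟩ := h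
    by_cases hs : s = 0
    · have ht := hst hs
      subst hs
      simp_all
    · refine ⟨?_, ?_, ?_⟩ <;> refine (mul_eq_zero.mp ?_).resolve_left hs
      · linear_combination e * h₁ - d * h₂
      · linear_combination f * h₁ - d * h₃
      · linear_combination f * h₂ - e * h₃
  · rintro ⟨h₁, h₂, h₃⟩ h
    have ha := h d (-a) ⟨by ring, by linear_combination -h₁, by linear_combination -h₂⟩
    have hb := h e (-b) ⟨by linear_combination h₁, by ring, by linear_combination -h₃⟩
    have hc := h f (-c) ⟨by linear_combination h₂, by linear_combination h₃, by ring⟩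
    simp only [neg_eq_zero] at ha hb hc
    simpa [ha, hb, hc] using h 1 0


/-- At a criminant point `(z₀, p₀)` of `F = p³ + A(x,y)p + B(x,y)` (where `F = F_p = 0`),
the Jacobian matrix of `(F, F_p)` with respect to `(x, y, p)` has rank `< 2` iff the four
equations defining the variety `R` hold; moreover `4A³ + 27B² = 0` holds automatically. -/
theorem rank_drop_iff_variety_R (A B : ℝ × ℝ → ℝ) (z₀ : ℝ × ℝ)
    (hA : DifferentiableAt ℝ A z₀) (hB : DifferentiableAt ℝ B z₀)
    (p₀ : ℝ) (hroot : p₀ ^ 3 + A z₀ * p₀ + B z₀ = 0)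
    (hdroot : 3 * p₀ ^ 2 + A z₀ = 0) :
    ((Matrix.rank (!![fderiv ℝ A z₀ (1, 0) * p₀ + fderiv ℝ B z₀ (1, 0),
                      fderiv ℝ A z₀ (0, 1) * p₀ + fderiv ℝ B z₀ (0, 1), 0;
                      fderiv ℝ A z₀ (1, 0), fderiv ℝ A z₀ (0, 1), 6 * p₀]) < 2) ↔
      (4 * (A z₀) ^ 3 + 27 * (B z₀) ^ 2 = 0 ∧
       fderiv ℝ A z₀ (1, 0) * fderiv ℝ B z₀ (0, 1)
         - fderiv ℝ A z₀ (0, 1) * fderiv ℝ B z₀ (1, 0) = 0 ∧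
       3 * B z₀ * fderiv ℝ A z₀ (1, 0) - 2 * A z₀ * fderiv ℝ B z₀ (1, 0) = 0 ∧
       3 * B z₀ * fderiv ℝ A z₀ (0, 1) - 2 * A z₀ * fderiv ℝ B z₀ (0, 1) = 0)) ∧
    4 * (A z₀) ^ 3 + 27 * (B z₀) ^ 2 = 0 := by
  rw [Matrix.rank_lt_two_iff_minors]
  generalize fderiv ℝ A z₀ (1, 0) = Ax
  generalize fderiv ℝ A z₀ (0, 1) = Ay
  generalize fderiv ℝ B z₀ (1, 0) = Bx
  generalize fderiv ℝ B z₀ (0, 1) = By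
  have hA₀ : A z₀ = -3 * p₀ ^ 2 := by linear_combination hdroot
  have hB₀ : B z₀ = 2 * p₀ ^ 3 := by linear_combination hroot - p₀ * hdroot
  have hdisc : 4 * (A z₀) ^ 3 + 27 * (B z₀) ^ 2 = 0 := by
    rw [hA₀, hB₀]
    ring
  refine ⟨?_, hdisc⟩
  rw [hA₀, hB₀] at hdisc ⊢
  constructor
  · rintro ⟨h₁, h₂, h₃⟩
    exact ⟨hdisc, by linear_combination -h₁, by linear_combination p₀ * h₂,
      by linear_combination p₀ * h₃⟩
  · rintro ⟨-, h₁, h₂, h₃⟩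
    refine ⟨by linear_combination -h₁, ?_⟩
    by_cases hp : p₀ = 0
    · simp [hp]
    · constructor <;> refine (mul_eq_zero.mp ?_).resolve_left hp
      · linear_combination h₂
      · linear_combination h₃
end

section
/- Let F, G : ℝ² → ℝ be C² near the origin with F(0,0) = G(0,0) = 0, F_Y(0,0) ≠ 0, G_X(0,0) ≠ 0 and F_X(0,0) = 0 (subscripts denote partial derivatives in the variables (X,Y)). Define c₃ = F_Y³ + 2G F_Y G_Y² + F G_Y³, c₁ = 3F_X²F_Y + 2G(2F_X G_X G_Y + F_Y G_X²) + 3F G_X² G_Y, and c₀ = F_X³ + 2G F_X G_X² + F G_X³. Then c₃(0,0) = F_Y(0,0)³ ≠ 0, and the functions Ã = c₁/c₃ and B̃ = c₀/c₃, defined near the origin, satisfy: Ã(0,0) = 0, B̃(0,0) = 0, Ã_X(0,0) = 2G_X(0,0)³/F_Y(0,0)², Ã_Y(0,0) = 5G_X(0,0)²G_Y(0,0)/F_Y(0,0)², B̃_X(0,0) = 0, and B̃_Y(0,0) = G_X(0,0)³/F_Y(0,0)². -/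
/-- The partial derivative of a `C²` function in a fixed direction is differentiable. -/
lemma ContDiffAt.differentiableAt_fderiv_apply {E : Type*} [NormedAddCommGroup E]
    [NormedSpace ℝ E] {f : E → ℝ} {z : E} (hf : ContDiffAt ℝ 2 f z) (v : E) :
    DifferentiableAt ℝ (fun w => fderiv ℝ f w v) z :=
  ((hf.fderiv_right (m := 1) (by norm_num)).differentiableAt (by norm_num)).clm_apply
    (differentiableAt_const v)

/-- At a zero of the numerator, the derivative of a quotient is the derivative of the numerator
divided by the value of the denominator. -/
lemma HasFDerivAt.fderiv_div_apply_of_eq_zero {E : Type*} [NormedAddCommGroup E]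
    [NormedSpace ℝ E] {n d : E → ℝ} {z : E} {n' : E →L[ℝ] ℝ} (hn : HasFDerivAt n n' z)
    (hd : DifferentiableAt ℝ d z) (hn0 : n z = 0) (hd0 : d z ≠ 0) (v : E) :
    fderiv ℝ (fun w => n w / d w) z v = n' v / d z := by
  simp only [div_eq_mul_inv]
  rw [(hn.fun_mul (hd.fun_inv hd0).hasFDerivAt).fderiv]
  simp [hn0, mul_comm]

/-- Perturbation computation: a change of variables `y = F(X,Y)`, `x = G(X,Y)` preserving
the depressed form transforms `p³ + 2xp + y = 0` into `P³ + Ã P + B̃ = 0` with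
`Ã = c₁/c₃`, `B̃ = c₀/c₃`, and at the origin the first derivatives of `Ã`, `B̃` are
the stated expressions in `F_Y(0,0)`, `G_X(0,0)`, `G_Y(0,0)`. -/
theorem perturbation_first_derivatives (F G : ℝ × ℝ → ℝ)
    (hF : ContDiffAt ℝ 2 F (0, 0)) (hG : ContDiffAt ℝ 2 G (0, 0))
    (hF0 : F (0, 0) = 0) (hG0 : G (0, 0) = 0)
    (hFY : fderiv ℝ F (0, 0) (0, 1) ≠ 0)
    (hGX : fderiv ℝ G (0, 0) (1, 0) ≠ 0)
    (hFX : fderiv ℝ F (0, 0) (1, 0) = 0)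
    (c3 c1 c0 At Bt : ℝ × ℝ → ℝ)
    (hc3 : ∀ z, c3 z = (fderiv ℝ F z (0, 1)) ^ 3
        + 2 * G z * fderiv ℝ F z (0, 1) * (fderiv ℝ G z (0, 1)) ^ 2
        + F z * (fderiv ℝ G z (0, 1)) ^ 3)
    (hc1 : ∀ z, c1 z = 3 * (fderiv ℝ F z (1, 0)) ^ 2 * fderiv ℝ F z (0, 1)
        + 2 * G z * (2 * fderiv ℝ F z (1, 0) * fderiv ℝ G z (1, 0) * fderiv ℝ G z (0, 1)
            + fderiv ℝ F z (0, 1) * (fderiv ℝ G z (1, 0)) ^ 2)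
        + 3 * F z * (fderiv ℝ G z (1, 0)) ^ 2 * fderiv ℝ G z (0, 1))
    (hc0 : ∀ z, c0 z = (fderiv ℝ F z (1, 0)) ^ 3
        + 2 * G z * fderiv ℝ F z (1, 0) * (fderiv ℝ G z (1, 0)) ^ 2
        + F z * (fderiv ℝ G z (1, 0)) ^ 3)
    (hAt : ∀ z, At z = c1 z / c3 z) (hBt : ∀ z, Bt z = c0 z / c3 z) :
    c3 (0, 0) = (fderiv ℝ F (0, 0) (0, 1)) ^ 3 ∧ c3 (0, 0) ≠ 0 ∧
    At (0, 0) = 0 ∧ Bt (0, 0) = 0 ∧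
    fderiv ℝ At (0, 0) (1, 0)
      = 2 * (fderiv ℝ G (0, 0) (1, 0)) ^ 3 / (fderiv ℝ F (0, 0) (0, 1)) ^ 2 ∧
    fderiv ℝ At (0, 0) (0, 1)
      = 5 * (fderiv ℝ G (0, 0) (1, 0)) ^ 2 * fderiv ℝ G (0, 0) (0, 1)
          / (fderiv ℝ F (0, 0) (0, 1)) ^ 2 ∧
    fderiv ℝ Bt (0, 0) (1, 0) = 0 ∧
    fderiv ℝ Bt (0, 0) (0, 1)
      = (fderiv ℝ G (0, 0) (1, 0)) ^ 3 / (fderiv ℝ F (0, 0) (0, 1)) ^ 2 := by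
  have hF' := hF.differentiableAt (by norm_num)
  have hG' := hG.differentiableAt (by norm_num)
  have dFX := hF.differentiableAt_fderiv_apply (1, 0)
  have dFY := hF.differentiableAt_fderiv_apply (0, 1)
  have dGX := hG.differentiableAt_fderiv_apply (1, 0)
  have dGY := hG.differentiableAt_fderiv_apply (0, 1)
  have h3 : c3 (0, 0) = (fderiv ℝ F (0, 0) (0, 1)) ^ 3 := by simp [hc3, hF0, hG0]
  have h3' : c3 (0, 0) ≠ 0 := h3 ▸ pow_ne_zero 3 hFY
  have h1 : c1 (0, 0) = 0 := by simp [hc1, hF0, hG0, hFX]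
  have h0 : c0 (0, 0) = 0 := by simp [hc0, hF0, hG0, hFX]
  have d3 : DifferentiableAt ℝ c3 (0, 0) := by
    rw [funext hc3]
    fun_prop
  have d1 : HasFDerivAt c1 ((2 * fderiv ℝ F (0, 0) (0, 1) * (fderiv ℝ G (0, 0) (1, 0)) ^ 2) •
      fderiv ℝ G (0, 0) + (3 * (fderiv ℝ G (0, 0) (1, 0)) ^ 2 * fderiv ℝ G (0, 0) (0, 1)) •
      fderiv ℝ F (0, 0)) (0, 0) := by
    rw [funext hc1]
    refine HasFDerivAt.congr_fderiv
      (((((dFX.hasFDerivAt.pow 2).const_mul 3).fun_mul dFY.hasFDerivAt).fun_add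
        ((hG'.hasFDerivAt.const_mul 2).fun_mul
          ((((dFX.hasFDerivAt.const_mul 2).fun_mul dGX.hasFDerivAt).fun_mul
            dGY.hasFDerivAt).fun_add
              (dFY.hasFDerivAt.fun_mul (dGX.hasFDerivAt.pow 2))))).fun_add
        (((hF'.hasFDerivAt.const_mul 3).fun_mul (dGX.hasFDerivAt.pow 2)).fun_mul
          dGY.hasFDerivAt)) ?_
    refine ContinuousLinearMap.ext fun v => ?_
    simp [hFX, hF0, hG0]
    ring
  have d0 : HasFDerivAt c0 ((fderiv ℝ G (0, 0) (1, 0)) ^ 3 • fderiv ℝ F (0, 0)) (0, 0) := by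
    rw [funext hc0]
    refine HasFDerivAt.congr_fderiv
      (((dFX.hasFDerivAt.pow 3).fun_add
        (((hG'.hasFDerivAt.const_mul 2).fun_mul dFX.hasFDerivAt).fun_mul
          (dGX.hasFDerivAt.pow 2))).fun_add
        (hF'.hasFDerivAt.fun_mul (dGX.hasFDerivAt.pow 3))) ?_
    refine ContinuousLinearMap.ext fun v => ?_
    simp [hFX, hF0, hG0]
  refine ⟨h3, h3', by simp [hAt, h1], by simp [hBt, h0], ?_, ?_, ?_, ?_⟩
  · rw [funext hAt, d1.fderiv_div_apply_of_eq_zero d3 h1 h3', h3]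
    simp [hFX]
    field_simp
  · rw [funext hAt, d1.fderiv_div_apply_of_eq_zero d3 h1 h3', h3]
    simp
    field_simp
    ring
  · rw [funext hBt, d0.fderiv_div_apply_of_eq_zero d3 h0 h3', h3]
    simp [hFX]
  · rw [funext hBt, d0.fderiv_div_apply_of_eq_zero d3 h0 h3', h3]
    simp
    field_simp
end

section
/- Let A(x,y) = 4xy − (16/9)x⁴ and B(x,y) = y² + (64/81)x⁶ − (32/9)x³y (corresponding to the implicit ODE p³ + 4x(y − (4/9)x³)p + y² + (64/81)x⁶ − (32/9)yx³ = 0). Then the Chern connection form γ is closed on the open set {(x,y) : 4A³ + 27B² ≠ 0}: ∂γ₁/∂y = ∂γ₂/∂x there. Hence this 3-web is flat. -/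
/-- Coefficients of the homogeneous normal form
`p³ + 4x(y − (4/9)x³)p + y² + (64/81)x⁶ − (32/9)yx³ = 0`. -/
noncomputable def Aform : ℝ × ℝ → ℝ := fun z => 4 * z.1 * z.2 - (16 / 9) * z.1 ^ 4
noncomputable def Bform : ℝ × ℝ → ℝ := fun z =>
  z.2 ^ 2 + (64 / 81) * z.1 ^ 6 - (32 / 9) * z.1 ^ 3 * z.2

/-- First component `γ₁` of the Chern connection form. -/
noncomputable def gamma1 : ℝ × ℝ → ℝ := fun z =>
  (2 * (Aform z) ^ 2 * fderiv ℝ Aform z (1, 0) - 4 * (Aform z) ^ 2 * fderiv ℝ Bform z (0, 1)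
    + 6 * Aform z * Bform z * fderiv ℝ Aform z (0, 1)
    + 9 * Bform z * fderiv ℝ Bform z (1, 0)) /
  (4 * (Aform z) ^ 3 + 27 * (Bform z) ^ 2)

/-- Second component `γ₂` of the Chern connection form. -/
noncomputable def gamma2 : ℝ × ℝ → ℝ := fun z =>
  (4 * (Aform z) ^ 2 * fderiv ℝ Aform z (0, 1) + 6 * Aform z * fderiv ℝ Bform z (1, 0)
    + 18 * Bform z * fderiv ℝ Bform z (0, 1) - 9 * Bform z * fderiv ℝ Aform z (1, 0)) /
  (4 * (Aform z) ^ 3 + 27 * (Bform z) ^ 2)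

open ContinuousLinearMap in
theorem Aform_hasFDerivAt (z : ℝ × ℝ) :
    HasFDerivAt Aform ((4 * z.2 - (64 / 9) * z.1 ^ 3) • fst ℝ ℝ ℝ + (4 * z.1) • snd ℝ ℝ ℝ) z := by
  have hx : HasFDerivAt (fun w : ℝ × ℝ => w.1) (fst ℝ ℝ ℝ) z := hasFDerivAt_fst
  have hy : HasFDerivAt (fun w : ℝ × ℝ => w.2) (snd ℝ ℝ ℝ) z := hasFDerivAt_snd
  refine (((hx.const_mul 4).mul hy).sub ((hx.pow 4).const_mul (16 / 9))).congr_fderiv ?_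
  ext <;> simp
  ring

open ContinuousLinearMap in
theorem Bform_hasFDerivAt (z : ℝ × ℝ) :
    HasFDerivAt Bform (((128 / 27) * z.1 ^ 5 - (32 / 3) * z.1 ^ 2 * z.2) • fst ℝ ℝ ℝ +
      (2 * z.2 - (32 / 9) * z.1 ^ 3) • snd ℝ ℝ ℝ) z := by
  have hx : HasFDerivAt (fun w : ℝ × ℝ => w.1) (fst ℝ ℝ ℝ) z := hasFDerivAt_fst
  have hy : HasFDerivAt (fun w : ℝ × ℝ => w.2) (snd ℝ ℝ ℝ) z := hasFDerivAt_snd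
  refine (((hy.pow 2).add ((hx.pow 6).const_mul (64 / 81))).sub
    (((hx.pow 3).const_mul (32 / 9)).mul hy)).congr_fderiv ?_
  ext <;> simp
  ring

/-- The numerator of `γ₁` vanishes identically. -/
theorem gamma1_eq_zero : gamma1 = fun _ => 0 := by
  funext z
  simp only [gamma1, (Aform_hasFDerivAt z).fderiv, (Bform_hasFDerivAt z).fderiv]
  refine div_eq_zero_iff.mpr (Or.inl ?_)
  simp [Aform, Bform]
  ring

/-- The numerator of `γ₂` vanishes identically. -/
theorem gamma2_eq_zero : gamma2 = fun _ => 0 := by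
  funext z
  simp only [gamma2, (Aform_hasFDerivAt z).fderiv, (Bform_hasFDerivAt z).fderiv]
  refine div_eq_zero_iff.mpr (Or.inl ?_)
  simp [Aform, Bform]
  ring

/-- For `A = 4xy − (16/9)x⁴`, `B = y² + (64/81)x⁶ − (32/9)x³y` the Chern connection form is
closed on `{4A³ + 27B² ≠ 0}`: the corresponding 3-web is flat. -/
theorem flatness_of_homogeneous_normal_form :
    ∀ z : ℝ × ℝ, 4 * (Aform z) ^ 3 + 27 * (Bform z) ^ 2 ≠ 0 →
      fderiv ℝ gamma1 z (0, 1) = fderiv ℝ gamma2 z (1, 0) := by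
  intro z _
  simp [gamma1_eq_zero, gamma2_eq_zero]
end

section
/- Let A, B, A_x, A_y, B_x, B_y be real numbers with A ≠ 0. Then the four equations 4A³ + 27B² = 0, A_xB_y − A_yB_x = 0, 3BA_x − 2AB_x = 0, 3BA_y − 2AB_y = 0 hold simultaneously if and only if the three equations 27B² = −4A³, B_x = 3BA_x/(2A), B_y = 3BA_y/(2A) hold; in particular, on the region A ≠ 0 the second equation A_xB_y − A_yB_x = 0 is a consequence of the other three, and the solution set is the union over the two branches B = ±(2/(3√3))(−A)^{3/2} (requiring A < 0 when B ≠ 0) of graphs expressing (B, B_x, B_y) as functions of (A, A_x, A_y); hence this set has codimension 3 in ℝ⁶. -/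
theorem ne_zero_of_discriminant_eq_zero {A B : ℝ} (hA : A ≠ 0)
    (h : 4 * A ^ 3 + 27 * B ^ 2 = 0) : B ≠ 0 := by
  rintro rfl
  exact hA (by simpa using h)

theorem neg_of_discriminant_eq_zero {A B : ℝ} (hA : A ≠ 0)
    (h : 4 * A ^ 3 + 27 * B ^ 2 = 0) : A < 0 := by
  by_contra! hA'
  have hpos : 0 < A ^ 3 := pow_pos (lt_of_le_of_ne hA' hA.symm) 3
  linarith [sq_nonneg B]

/-- The two branches of the semicubical parabola `4A³ + 27B² = 0` away from the cusp. -/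
theorem eq_or_eq_neg_of_discriminant_eq_zero {A B : ℝ} (hA : A ≠ 0)
    (h : 4 * A ^ 3 + 27 * B ^ 2 = 0) :
    B = 2 / (3 * Real.sqrt 3) * (Real.sqrt (-A)) ^ 3 ∨
      B = -(2 / (3 * Real.sqrt 3) * (Real.sqrt (-A)) ^ 3) := by
  have hneg := neg_of_discriminant_eq_zero hA h
  have hs : Real.sqrt (-A) ^ 2 = -A := Real.sq_sqrt (by linarith)
  have h3 : Real.sqrt 3 ^ 2 = 3 := Real.sq_sqrt (by norm_num)
  rw [← sq_eq_sq_iff_eq_or_eq_neg]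
  calc B ^ 2 = 4 / (9 * 3) * (-A) ^ 3 := by linear_combination h / 27
    _ = 4 / (9 * Real.sqrt 3 ^ 2) * (Real.sqrt (-A) ^ 2) ^ 3 := by rw [hs, h3]
    _ = (2 / (3 * Real.sqrt 3) * Real.sqrt (-A) ^ 3) ^ 2 := by ring


/-- On the region `A ≠ 0`, the four equations defining the variety `R` are equivalent to
three independent ones (the equation `AₓB_y − A_yBₓ = 0` is a consequence of the others),
and the solution set is the union of two graphs expressing `(B, Bₓ, B_y)` in terms of
`(A, Aₓ, A_y)` along the branches `B = ±(2/(3√3))(−A)^{3/2}`; hence `R` has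
codimension 3. -/
theorem variety_R_codim_three (A B Ax Ay Bx By : ℝ) (hA : A ≠ 0) :
    ((4 * A ^ 3 + 27 * B ^ 2 = 0 ∧ Ax * By - Ay * Bx = 0 ∧
      3 * B * Ax - 2 * A * Bx = 0 ∧ 3 * B * Ay - 2 * A * By = 0) ↔
     (27 * B ^ 2 = -(4 * A ^ 3) ∧ Bx = 3 * B * Ax / (2 * A) ∧ By = 3 * B * Ay / (2 * A))) ∧
    ((4 * A ^ 3 + 27 * B ^ 2 = 0 ∧ Ax * By - Ay * Bx = 0 ∧
      3 * B * Ax - 2 * A * Bx = 0 ∧ 3 * B * Ay - 2 * A * By = 0) →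
     (A < 0 ∧ B ≠ 0 ∧
      (B = 2 / (3 * Real.sqrt 3) * (Real.sqrt (-A)) ^ 3 ∨
       B = -(2 / (3 * Real.sqrt 3) * (Real.sqrt (-A)) ^ 3)))) := by
  refine ⟨⟨?_, ?_⟩, ?_⟩
  · rintro ⟨hdisc, -, hx, hy⟩
    refine ⟨by linarith, ?_, ?_⟩
    · rw [eq_div_iff (by simpa using hA)]
      linarith
    · rw [eq_div_iff (by simpa using hA)]
      linarith
  · rintro ⟨hdisc, rfl, rfl⟩
    refine ⟨by linarith, by ring, ?_, ?_⟩ <;> field_simp <;> ring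
  · rintro ⟨hdisc, -⟩
    exact ⟨neg_of_discriminant_eq_zero hA hdisc, ne_zero_of_discriminant_eq_zero hA hdisc,
      eq_or_eq_neg_of_discriminant_eq_zero hA hdisc⟩
end

section
/- Let A, B be C^∞ functions on a neighborhood U of z₀ = (x₀,y₀) in ℝ² with A(z₀) = B(z₀) = 0 and (A_xB_y − A_yB_x)(z₀) ≠ 0, and suppose the Chern connection form γ of the web of p³ + A(x,y)p + B(x,y) = 0 is closed on {(x,y) ∈ U : 4A³ + 27B² ≠ 0} (i.e., the web is flat). Then B_x(z₀) = 0; equivalently, the contact plane dy − p dx = 0 is tangent to the surface {p³ + A(x,y)p + B(x,y) = 0} at the triple-root point (x₀, y₀, 0). -/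
/-- The quotient rule for Fréchet derivatives, with denominators cleared. -/
theorem fderiv_div_apply_mul_sq {E : Type*} [NormedAddCommGroup E] [NormedSpace ℝ E]
    {N D : E → ℝ} {z : E} (hN : DifferentiableAt ℝ N z) (hD : DifferentiableAt ℝ D z)
    (h0 : D z ≠ 0) (v : E) :
    fderiv ℝ (fun w => N w / D w) z v * D z ^ 2 =
      fderiv ℝ N z v * D z - N z * fderiv ℝ D z v := by
  have hQ : DifferentiableAt ℝ (fun w => N w / D w) z := by
    simpa only [div_eq_mul_inv] using hN.fun_mul (hD.fun_inv h0)
  have heq : (fun w => N w / D w * D w) =ᶠ[nhds z] N := by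
    filter_upwards [hD.continuousAt.eventually_ne h0] with w hw
    exact div_mul_cancel₀ _ hw
  rw [← heq.fderiv_eq, fderiv_fun_mul hQ hD]
  simp only [add_apply, smul_apply, smul_eq_mul]
  field_simp
  ring

theorem fderiv_cubic_discriminant_apply {E : Type*} [NormedAddCommGroup E] [NormedSpace ℝ E]
    {A B : E → ℝ} {z : E} (hA : DifferentiableAt ℝ A z) (hB : DifferentiableAt ℝ B z) (v : E) :
    fderiv ℝ (fun w => 4 * A w ^ 3 + 27 * B w ^ 2) z v =
      12 * A z ^ 2 * fderiv ℝ A z v + 54 * B z * fderiv ℝ B z v := by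
  have h := (((hA.hasFDerivAt.pow 3).const_mul 4).add ((hB.hasFDerivAt.pow 2).const_mul 27)).fderiv
  have h' : fderiv ℝ (fun w => 4 * A w ^ 3 + 27 * B w ^ 2) z = _ := h
  rw [h']
  simp
  ring

theorem map_nhds_prodMk_of_det_ne_zero {A B : ℝ × ℝ → ℝ} {z₀ : ℝ × ℝ}
    {A' B' : ℝ × ℝ →L[ℝ] ℝ} (hA : HasStrictFDerivAt A A' z₀) (hB : HasStrictFDerivAt B B' z₀)
    (hdet : A' (1, 0) * B' (0, 1) - A' (0, 1) * B' (1, 0) ≠ 0) :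
    Filter.map (fun z => (A z, B z)) (nhds z₀) = nhds (A z₀, B z₀) := by
  refine (hA.prodMk hB).map_nhds_eq_of_surj (LinearMap.range_eq_top.2 fun w => ?_)
  set d := A' (1, 0) * B' (0, 1) - A' (0, 1) * B' (1, 0) with hd
  refine ⟨((w.1 * B' (0, 1) - w.2 * A' (0, 1)) / d) • ((1, 0) : ℝ × ℝ) +
    ((w.2 * A' (1, 0) - w.1 * B' (1, 0)) / d) • ((0, 1) : ℝ × ℝ), ?_⟩
  simp only [ContinuousLinearMap.coe_coe, map_add, map_smul, ContinuousLinearMap.prod_apply]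
  ext
  · simp only [Prod.smul_mk, smul_eq_mul, Prod.mk_add_mk]
    field_simp
    rw [hd]
    ring
  · simp only [Prod.smul_mk, smul_eq_mul, Prod.mk_add_mk]
    field_simp
    rw [hd]
    ring

/-- Every neighbourhood of a preimage of the origin meets the preimage of the punctured semicubical
parabola `(t², t³)`, with arbitrarily small parameter. -/
theorem exists_semicubical_of_map_nhds {A B : ℝ × ℝ → ℝ} {z₀ : ℝ × ℝ}
    (hmap : Filter.map (fun z => (A z, B z)) (nhds z₀) = nhds (0, 0))
    {P : (ℝ × ℝ) × ℝ → Prop} (hP : ∀ᶠ q in nhds z₀ ×ˢ nhds (0 : ℝ), P q) :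
    ∃ z t, t ≠ 0 ∧ A z = t ^ 2 ∧ B z = t ^ 3 ∧ P (z, t) := by
  obtain ⟨Q, hQ, R, hR, hQR⟩ := Filter.eventually_prod_iff.1 hP
  have himg : (fun z => (A z, B z)) '' {z | Q z} ∈ nhds ((0 : ℝ), (0 : ℝ)) :=
    hmap ▸ Filter.image_mem_map hQ
  have hcurve : Filter.Tendsto (fun t : ℝ => (t ^ 2, t ^ 3)) (nhds 0) (nhds (0, 0)) :=
    (by fun_prop : Continuous fun t : ℝ => (t ^ 2, t ^ 3)).tendsto' _ _ (by simp)
  have hev : ∀ᶠ t : ℝ in nhdsWithin 0 {0}ᶜ, (t ^ 2, t ^ 3) ∈ (fun z => (A z, B z)) '' {z | Q z} ∧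
      R t := ((hcurve.eventually himg).and hR).filter_mono nhdsWithin_le_nhds
  obtain ⟨t, ⟨⟨z, hz, hzt⟩, ht⟩, ht0⟩ := (hev.and self_mem_nhdsWithin).exists
  exact ⟨z, t, ht0, congrArg Prod.fst hzt, congrArg Prod.snd hzt, hQR hz ht⟩

/-- For a flat web of `p³ + A(x,y)p + B(x,y) = 0` with `A(z₀) = B(z₀) = 0` (triple root)
satisfying the regularity condition `(AₓB_y − A_yBₓ)(z₀) ≠ 0`, the closedness of the Chern
connection form on `{4A³ + 27B² ≠ 0}` forces `Bₓ(z₀) = 0`, i.e. the contact plane is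
tangent to the surface `{p³ + Ap + B = 0}` at the triple-root criminant point. -/
theorem triple_root_is_legendrian_for_flat_web
    (A B : ℝ × ℝ → ℝ) (z₀ : ℝ × ℝ) (U : Set (ℝ × ℝ))
    (hU : IsOpen U) (hz₀ : z₀ ∈ U)
    (hA : ContDiffOn ℝ (⊤ : ℕ∞) A U) (hB : ContDiffOn ℝ (⊤ : ℕ∞) B U)
    (hA0 : A z₀ = 0) (hB0 : B z₀ = 0)
    (hreg : fderiv ℝ A z₀ (1, 0) * fderiv ℝ B z₀ (0, 1)
        - fderiv ℝ A z₀ (0, 1) * fderiv ℝ B z₀ (1, 0) ≠ 0)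
    (γ1 γ2 : ℝ × ℝ → ℝ)
    (hγ1 : ∀ z, γ1 z =
      (2 * (A z) ^ 2 * fderiv ℝ A z (1, 0) - 4 * (A z) ^ 2 * fderiv ℝ B z (0, 1)
        + 6 * A z * B z * fderiv ℝ A z (0, 1) + 9 * B z * fderiv ℝ B z (1, 0)) /
      (4 * (A z) ^ 3 + 27 * (B z) ^ 2))
    (hγ2 : ∀ z, γ2 z =
      (4 * (A z) ^ 2 * fderiv ℝ A z (0, 1) + 6 * A z * fderiv ℝ B z (1, 0)
        + 18 * B z * fderiv ℝ B z (0, 1) - 9 * B z * fderiv ℝ A z (1, 0)) /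
      (4 * (A z) ^ 3 + 27 * (B z) ^ 2))
    (hflat : ∀ z ∈ U, 4 * (A z) ^ 3 + 27 * (B z) ^ 2 ≠ 0 →
      fderiv ℝ γ1 z (0, 1) = fderiv ℝ γ2 z (1, 0)) :
    fderiv ℝ B z₀ (1, 0) = 0 := by
  have hUn := hU.mem_nhds hz₀
  have hA₀ := hA.contDiffAt hUn
  have hB₀ := hB.contDiffAt hUn
  have hmap := map_nhds_prodMk_of_det_ne_zero (hA₀.hasStrictFDerivAt (by simp))
    (hB₀.hasStrictFDerivAt (by simp)) hreg
  rw [hA0, hB0] at hmap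
  set N₁ : ℝ × ℝ → ℝ := fun z =>
    2 * (A z) ^ 2 * fderiv ℝ A z (1, 0) - 4 * (A z) ^ 2 * fderiv ℝ B z (0, 1)
      + 6 * A z * B z * fderiv ℝ A z (0, 1) + 9 * B z * fderiv ℝ B z (1, 0) with hN₁
  set N₂ : ℝ × ℝ → ℝ := fun z =>
    4 * (A z) ^ 2 * fderiv ℝ A z (0, 1) + 6 * A z * fderiv ℝ B z (1, 0)
      + 18 * B z * fderiv ℝ B z (0, 1) - 9 * B z * fderiv ℝ A z (1, 0) with hN₂
  set D : ℝ × ℝ → ℝ := fun z => 4 * (A z) ^ 3 + 27 * (B z) ^ 2 with hD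
  have hγ1' : γ1 = fun z => N₁ z / D z := funext hγ1
  have hγ2' : γ2 = fun z => N₂ z / D z := funext hγ2
  have hpartial : ∀ {f : ℝ × ℝ → ℝ}, ContDiffOn ℝ (⊤ : ℕ∞) f U → ∀ v : ℝ × ℝ,
      ContDiffOn ℝ (⊤ : ℕ∞) (fun z => fderiv ℝ f z v) U := fun hf v =>
    (hf.fderiv_of_isOpen hU (by simp)).clm_apply contDiffOn_const
  have hAx := hpartial hA (1, 0)
  have hAy := hpartial hA (0, 1)
  have hBx := hpartial hB (1, 0)
  have hBy := hpartial hB (0, 1)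
  have hN₁s : ContDiffOn ℝ (⊤ : ℕ∞) N₁ U := by fun_prop
  have hN₂s : ContDiffOn ℝ (⊤ : ℕ∞) N₂ U := by fun_prop
  have hlim : Filter.Tendsto (fun q : (ℝ × ℝ) × ℝ =>
      31 * q.2 * (fderiv ℝ N₁ q.1 (0, 1) - fderiv ℝ N₂ q.1 (1, 0))
      - q.2 * (2 * q.2 * fderiv ℝ A q.1 (1, 0) - 4 * q.2 * fderiv ℝ B q.1 (0, 1)
          + 6 * q.2 ^ 2 * fderiv ℝ A q.1 (0, 1) + 9 * fderiv ℝ B q.1 (1, 0))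
        * (12 * q.2 * fderiv ℝ A q.1 (0, 1) + 54 * fderiv ℝ B q.1 (0, 1))
      + (4 * q.2 ^ 2 * fderiv ℝ A q.1 (0, 1) + 6 * fderiv ℝ B q.1 (1, 0)
          + 18 * q.2 * fderiv ℝ B q.1 (0, 1) - 9 * q.2 * fderiv ℝ A q.1 (1, 0))
        * (12 * q.2 * fderiv ℝ A q.1 (1, 0) + 54 * fderiv ℝ B q.1 (1, 0)))
      (nhds z₀ ×ˢ nhds 0) (nhds (324 * fderiv ℝ B z₀ (1, 0) ^ 2)) := by
    have hc : ∀ {f : ℝ × ℝ → ℝ}, ContDiffOn ℝ (⊤ : ℕ∞) f U →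
        ContinuousAt (fun q : (ℝ × ℝ) × ℝ => f q.1) (z₀, 0) := fun hf =>
      ContinuousAt.comp' (f := Prod.fst) (hf.continuousOn.continuousAt hUn) continuousAt_fst
    have h1 := hc (hpartial hN₁s (0, 1))
    have h2 := hc (hpartial hN₂s (1, 0))
    have h3 := hc hAx
    have h4 := hc hAy
    have h5 := hc hBx
    have h6 := hc hBy
    rw [← nhds_prod_eq]
    convert ContinuousAt.tendsto (x := (z₀, (0 : ℝ))) ?_ using 2
    · ring
    · fun_prop
  by_contra hr
  have hne := (hlim.eventually_ne (by positivity)).and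
    (Filter.tendsto_fst.eventually hUn : ∀ᶠ q : (ℝ × ℝ) × ℝ in nhds z₀ ×ˢ nhds 0, q.1 ∈ U)
  obtain ⟨z, t, ht, hAt, hBt, hG, hzU⟩ := exists_semicubical_of_map_nhds hmap hne
  have hzn := hU.mem_nhds hzU
  have hdiff : ∀ {f : ℝ × ℝ → ℝ}, ContDiffOn ℝ (⊤ : ℕ∞) f U → DifferentiableAt ℝ f z := fun hf =>
    (hf.contDiffAt hzn).differentiableAt (by simp)
  have hDt : D z = 31 * t ^ 6 := by simp only [hD, hAt, hBt]; ring
  have hD0 : D z ≠ 0 := by rw [hDt]; positivity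
  have hDd : DifferentiableAt ℝ D z := by
    have := hdiff hA
    have := hdiff hB
    fun_prop
  have hflat' := hflat z hzU hD0
  have e1 := fderiv_div_apply_mul_sq (hdiff hN₁s) hDd hD0 (0, 1)
  have e2 := fderiv_div_apply_mul_sq (hdiff hN₂s) hDd hD0 (1, 0)
  rw [← hγ1', hflat', hγ2', e2] at e1
  have d1 := fderiv_cubic_discriminant_apply (hdiff hA) (hdiff hB) (1, 0)
  have d2 := fderiv_cubic_discriminant_apply (hdiff hA) (hdiff hB) (0, 1)
  rw [d1, d2, hDt] at e1
  have n1 : N₁ z = t ^ 3 * (2 * t * fderiv ℝ A z (1, 0) - 4 * t * fderiv ℝ B z (0, 1)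
      + 6 * t ^ 2 * fderiv ℝ A z (0, 1) + 9 * fderiv ℝ B z (1, 0)) := by
    simp only [hN₁, hAt, hBt]
    ring
  have n2 : N₂ z = t ^ 2 * (4 * t ^ 2 * fderiv ℝ A z (0, 1) + 6 * fderiv ℝ B z (1, 0)
      + 18 * t * fderiv ℝ B z (0, 1) - 9 * t * fderiv ℝ A z (1, 0)) := by
    simp only [hN₂, hAt, hBt]
    ring
  rw [n1, n2, hAt, hBt] at e1
  refine hG (mul_left_cancel₀ (pow_ne_zero 5 ht) ?_)
  linear_combination -e1
end
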